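/- Let k be a field of characteristic p > 0, G a group, and V a finite-dimensional linear representation of G over k such that V has no G-stable codimension-1 subspace (equivalently, the dual representation V^* has no nonzero G-fixed vector). Then the map φ: (S^p(V^*))^G → (S''_p(V^*))^G induced by the multilinearization map on G-invariants is injective. In particular, for p = 2: every G-invariant quadratic form on V whose polar bilinear form vanishes identically is the zero form. -/

import Mathlib

/-!
STATEMENT 4: Let k be a field of characteristic p > 0, G a group, and V a
finite-dimensional representation of G over k with no G-stable codimension-1
subspace.  Then the multilinearization map φ : S^p(V^*) → S''_p(V^*) is injective
on G-invariants.  In particular, for p = 2: every G-invariant quadratic form on V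
whose polar bilinear form vanishes identically is the zero form.
-/

open scoped TensorProduct

variable (k : Type*) [Field k] (V : Type*) [AddCommGroup V] [Module k V] (n : ℕ)

section SymmetricPower

variable (W : Type*) [AddCommGroup W] [Module k W]

/-- The action of a permutation `σ` on the `n`-th tensor power of `W`,
permuting the tensor factors. -/
noncomputable def permAct (σ : Equiv.Perm (Fin n)) :
    (⨂[k] (_ : Fin n), W) →ₗ[k] ⨂[k] (_ : Fin n), W :=
  (PiTensorProduct.reindex k (fun _ : Fin n => W) σ).toLinearMap

/-- The symmetrization map `s : ⊗^n W → ⊗^n W`, `s(x) = ∑_{σ ∈ Σ_n} σ x`. -/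
noncomputable def symmetrize : (⨂[k] (_ : Fin n), W) →ₗ[k] ⨂[k] (_ : Fin n), W :=
  ∑ σ : Equiv.Perm (Fin n), permAct k n W σ

/-- `S''_n(W)`, the space of symmetrized tensors. -/
noncomputable def symmetrizedTensors : Submodule k (⨂[k] (_ : Fin n), W) :=
  LinearMap.range (symmetrize k n W)

/-- The relations defining the symmetric power: the span of all `x - σ x`. -/
noncomputable def symRel : Submodule k (⨂[k] (_ : Fin n), W) :=
  Submodule.span k
    {x | ∃ (y : ⨂[k] (_ : Fin n), W) (σ : Equiv.Perm (Fin n)), x = y - permAct k n W σ y}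

/-- The `n`-th symmetric power `S^n(W)`. -/
noncomputable abbrev SymPow := (⨂[k] (_ : Fin n), W) ⧸ symRel k n W

/-- The quotient map `ρ : ⊗^n W → S^n(W)`. -/
noncomputable def symQuot : (⨂[k] (_ : Fin n), W) →ₗ[k] SymPow k n W :=
  (symRel k n W).mkQ

end SymmetricPower

variable {G : Type*} [Group G]

/-- The contragredient (dual) action of `g ∈ G` on `V^* = Dual k V`:
`(g · f)(v) = f(g⁻¹ v)`. -/
noncomputable def dualAct (ρ : Representation k G V) (g : G) :
    Module.Dual k V →ₗ[k] Module.Dual k V :=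
  (ρ g⁻¹).dualMap

/-- The induced action of `g ∈ G` on the `n`-th tensor power of `V^*`. -/
noncomputable def tensorDualAct (ρ : Representation k G V) (g : G) :
    (⨂[k] (_ : Fin n), Module.Dual k V) →ₗ[k] ⨂[k] (_ : Fin n), Module.Dual k V :=
  PiTensorProduct.map fun _ : Fin n => dualAct k V ρ g

/-- `x ∈ S^n(V^*)` is `G`-invariant for the induced action: the image of any lift of
`x` under the action of any `g ∈ G` is again a lift of `x`. -/
def GInvariant (ρ : Representation k G V) (x : SymPow k n (Module.Dual k V)) : Prop :=
  ∀ (g : G) (y : ⨂[k] (_ : Fin n), Module.Dual k V),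
    symQuot k n (Module.Dual k V) y = x →
      symQuot k n (Module.Dual k V) (tensorDualAct k V n ρ g y) = x

open Module in
/-- If `V` has no `G`-stable subspace of codimension one, then every `G`-invariant linear map
from `V` to a `k`-module with trivial action vanishes. -/
theorem eq_zero_of_invariant_of_no_stable_hyperplane {M : Type*} [AddCommGroup M] [Module k M]
    (ρ : Representation k G V)
    (hcodim : ∀ U : Submodule k V, (∀ g : G, ∀ v ∈ U, ρ g v ∈ U) → finrank k (V ⧸ U) ≠ 1)
    (N : V →ₗ[k] M) (hN : ∀ (g : G) (v : V), N (ρ g v) = N v) : N = 0 := by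
  by_contra hne
  obtain ⟨v, hv⟩ : ∃ v, N v ≠ 0 := by
    by_contra! h
    exact hne (LinearMap.ext h)
  obtain ⟨l, hl⟩ : ∃ l : Dual k M, l (N v) ≠ 0 := by
    by_contra! h
    exact hv ((forall_dual_apply_eq_zero_iff k _).mp h)
  have hsurj : Function.Surjective (l ∘ₗ N) :=
    LinearMap.surjective fun h => hl (by simpa using LinearMap.congr_fun h v)
  refine hcodim (LinearMap.ker (l ∘ₗ N)) (fun g u hu => ?_) ?_
  · simpa [hN] using hu
  · rw [((l ∘ₗ N).quotKerEquivOfSurjective hsurj).finrank_eq, finrank_self]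

/-- A `G`-invariant additive map `V → k` that is semilinear with respect to the Frobenius vanishes
if `V` has no `G`-stable subspace of codimension one. -/
theorem eq_zero_of_invariant_frobenius_semilinear (p : ℕ) [Fact p.Prime] [CharP k p]
    (ρ : Representation k G V)
    (hcodim : ∀ U : Submodule k V, (∀ g : G, ∀ v ∈ U, ρ g v ∈ U) →
      Module.finrank k (V ⧸ U) ≠ 1)
    (N : V → k) (hadd : ∀ v w, N (v + w) = N v + N w) (hsmul : ∀ (c : k) v, N (c • v) = c ^ p * N v)
    (hN : ∀ (g : G) (v : V), N (ρ g v) = N v) (v : V) : N v = 0 :=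
  let m : Module k k := Module.compHom k (frobenius k p)
  let L : @LinearMap k k _ _ (RingHom.id k) V k _ _ _ m :=
    @LinearMap.mk _ _ _ _ (RingHom.id k) _ _ _ _ _ m ⟨N, hadd⟩ hsmul
  congrArg (fun L' : @LinearMap k k _ _ (RingHom.id k) V k _ _ _ m => L'.toFun v)
    (@eq_zero_of_invariant_of_no_stable_hyperplane k _ V _ _ G _ k _ m ρ hcodim L hN)

section Kernel

variable (W : Type*) [AddCommGroup W] [Module k W]

theorem permAct_tprod (σ : Equiv.Perm (Fin n)) (f : Fin n → W) :
    permAct k n W σ (PiTensorProduct.tprod k f) = PiTensorProduct.tprod k (f ∘ σ.symm) :=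
  PiTensorProduct.reindex_tprod σ f

theorem symQuot_permAct (σ : Equiv.Perm (Fin n)) (y : ⨂[k] (_ : Fin n), W) :
    symQuot k n W (permAct k n W σ y) = symQuot k n W y :=
  ((Submodule.Quotient.eq (symRel k n W)).mpr (Submodule.subset_span ⟨y, σ, rfl⟩)).symm

/-- A linear map on `⊗^n W` that is invariant under permutations factors through `S^n(W)`. -/
theorem apply_eq_of_symQuot_eq {M : Type*} [AddCommGroup M] [Module k M]
    (L : (⨂[k] (_ : Fin n), W) →ₗ[k] M) (hL : ∀ σ y, L (permAct k n W σ y) = L y)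
    {y z : ⨂[k] (_ : Fin n), W} (h : symQuot k n W y = symQuot k n W z) : L y = L z := by
  have hle : symRel k n W ≤ LinearMap.ker L := by
    rw [symRel, Submodule.span_le]
    rintro _ ⟨y, σ, rfl⟩
    rw [SetLike.mem_coe, LinearMap.mem_ker, map_sub, hL, sub_self]
  have hker := hle ((Submodule.Quotient.eq (symRel k n W)).mp h)
  rwa [LinearMap.mem_ker, map_sub, sub_eq_zero] at hker

/-- The stabilizer in `Σ_p` of a nonconstant word of length `p` has order prime to `p`. -/
theorem card_stabilizer_ne_zero {ι : Type*} [Fintype ι] [DecidableEq ι] (p : ℕ) [Fact p.Prime]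
    [CharP k p] (f : Fin p → ι) (hf : ∀ i, f ≠ fun _ => i) :
    ((Fintype.card {σ : Equiv.Perm (Fin p) // f ∘ σ = f} : ℕ) : k) ≠ 0 := by
  have hp : p.Prime := Fact.out
  rw [Ne, CharP.cast_eq_zero_iff k p, DomMulAct.stabilizer_card,
    hp.prime.dvd_finsetProd_iff]
  rintro ⟨i, -, hi⟩
  rw [hp.dvd_factorial] at hi
  refine hf i (funext fun a => ?_)
  by_contra ha
  have := Fintype.card_subtype_lt (p := fun a => f a = i) ha
  rw [Fintype.card_fin] at this
  omega

/-- There is a weight on words of length `p` whose sum over the permutations of any nonconstant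
word is `1`. -/
theorem exists_weight_sum_eq_one (ι : Type*) [Finite ι] (p : ℕ) [Fact p.Prime] [CharP k p] :
    ∃ w : (Fin p → ι) → k, ∀ f : Fin p → ι, (∀ i, f ≠ fun _ => i) →
      ∑ σ : Equiv.Perm (Fin p), w (f ∘ σ) = 1 := by
  classical
  have := Fintype.ofFinite ι
  let S : Setoid (Fin p → ι) :=
    { r := fun f g => ∃ σ : Equiv.Perm (Fin p), f ∘ σ = g
      iseqv :=
        { refl := fun f => ⟨1, rfl⟩
          symm := by
            rintro f g ⟨σ, rfl⟩
            exact ⟨σ⁻¹, by ext; simp⟩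
          trans := by
            rintro f g h ⟨σ, rfl⟩ ⟨τ, rfl⟩
            exact ⟨σ * τ, rfl⟩ } }
  let rep : (Fin p → ι) → (Fin p → ι) := fun f => (Quotient.mk S f).out
  have hrep (f) : ∃ σ : Equiv.Perm (Fin p), f ∘ σ = rep f := S.symm (Quotient.mk_out f)
  have hrep' (f) (σ : Equiv.Perm (Fin p)) : rep (f ∘ σ) = rep f :=
    congrArg Quotient.out (Quotient.sound (s := S) (S.symm ⟨σ, rfl⟩))
  refine ⟨fun f => if f = rep f then
    ((Fintype.card {σ : Equiv.Perm (Fin p) // rep f ∘ σ = rep f} : ℕ) : k)⁻¹ else 0,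
    fun f hf => ?_⟩
  obtain ⟨τ, hτ⟩ := hrep f
  have hne : ∀ i, rep f ≠ fun _ => i := by
    intro i hi
    refine hf i (funext fun a => ?_)
    simpa using congrFun (hτ.trans hi) (τ⁻¹ a)
  rw [← Equiv.sum_comp (Equiv.mulLeft τ)]
  have hcomp (σ : Equiv.Perm (Fin p)) : f ∘ (τ * σ : Equiv.Perm (Fin p)) = rep f ∘ σ := by
    rw [← hτ]
    rfl
  have hrr : rep (rep f) = rep f := by
    conv_lhs => rw [← hτ, hrep']
  simp only [Equiv.coe_mulLeft, hcomp, hrep', hrr]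
  rw [← Finset.sum_filter, Finset.sum_const, ← Fintype.card_subtype, nsmul_eq_mul,
    mul_inv_cancel₀ (card_stabilizer_ne_zero k p _ hne)]

/-- In characteristic `p`, the kernel of multilinearization in degree `p` is spanned by the
`p`-th powers of the elements of a basis. -/
theorem exists_symQuot_eq_sum_pow {ι : Type*} [Fintype ι] (b : Module.Basis ι k W) (p : ℕ)
    [Fact p.Prime] [CharP k p] (y : ⨂[k] (_ : Fin p), W) (hy : symmetrize k p W y = 0) :
    ∃ c : ι → k, symQuot k p W y =
      ∑ i, c i • symQuot k p W (PiTensorProduct.tprod k fun _ => b i) := by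
  classical
  obtain ⟨w, hw⟩ := exists_weight_sum_eq_one k ι p
  let B := Basis.piTensorProduct fun _ : Fin p => b
  have hB (f) : B f = PiTensorProduct.tprod k fun a => b (f a) := Basis.piTensorProduct_apply _ f
  let ψ : (⨂[k] (_ : Fin p), W) →ₗ[k] SymPow k p W :=
    B.constr k fun f => w f • symQuot k p W (B f)
  let P : (⨂[k] (_ : Fin p), W) →ₗ[k] SymPow k p W :=
    ∑ i, (B.coord fun _ => i).smulRight (symQuot k p W (B fun _ => i))
  have hperm (σ : Equiv.Perm (Fin p)) (f) : permAct k p W σ (B f) = B (f ∘ σ.symm) := by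
    rw [hB, permAct_tprod, hB]
    rfl
  have hPB (f) : P (B f) = ∑ i, if f = fun _ => i then symQuot k p W (B f) else 0 := by
    simp only [P, LinearMap.sum_apply, LinearMap.smulRight_apply, Module.Basis.coord_apply,
      Module.Basis.repr_self, Finsupp.single_apply, ite_smul, one_smul, zero_smul]
    refine Finset.sum_congr rfl fun i _ => ?_
    split_ifs with h
    · rw [h]
    · rfl
  have hsum (f) : ψ (symmetrize k p W (B f)) =
      (∑ σ : Equiv.Perm (Fin p), w (f ∘ σ)) • symQuot k p W (B f) := by
    rw [← Equiv.sum_comp (Equiv.inv (Equiv.Perm (Fin p))), Finset.sum_smul, symmetrize,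
      LinearMap.sum_apply, map_sum]
    refine Finset.sum_congr rfl fun σ _ => ?_
    rw [← symQuot_permAct k p W σ (B f), hperm]
    exact B.constr_basis k _ _
  have key : ψ ∘ₗ symmetrize k p W + P = symQuot k p W := by
    refine B.ext fun f => ?_
    rw [LinearMap.add_apply, LinearMap.comp_apply, hsum, hPB]
    by_cases hf : ∀ i, f ≠ fun _ => i
    · simp [hw f hf, hf]
    · push Not at hf
      obtain ⟨i, rfl⟩ := hf
      have hp : p.Prime := Fact.out
      have : NeZero p := ⟨hp.ne_zero⟩
      have hfact : ((p.factorial : ℕ) : k) = 0 :=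
        (CharP.cast_eq_zero_iff k p _).mpr (hp.dvd_factorial.mpr le_rfl)
      have hconst (σ : Equiv.Perm (Fin p)) : (fun _ => i) ∘ σ = fun _ : Fin p => i := rfl
      simp [hconst, Fintype.card_perm, hfact, funext_iff]
  refine ⟨fun i => B.repr y fun _ => i, ?_⟩
  rw [← LinearMap.congr_fun key y, LinearMap.add_apply, LinearMap.comp_apply, hy, map_zero,
    zero_add]
  simp [P, hB]

end Kernel

/-- Evaluation of elements of `⊗^n V^*`, viewed as polynomial functions, at a vector. -/
noncomputable def tensorEval (v : V) : (⨂[k] (_ : Fin n), Module.Dual k V) →ₗ[k] k :=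
  PiTensorProduct.lift ((MultilinearMap.mkPiAlgebra k (Fin n) k).compLinearMap
    fun _ => (LinearMap.applyₗ v : (V →ₗ[k] k) →ₗ[k] k))

theorem tensorEval_tprod (v : V) (f : Fin n → Module.Dual k V) :
    tensorEval k V n v (PiTensorProduct.tprod k f) = ∏ i, f i v :=
  PiTensorProduct.lift.tprod _

theorem tensorEval_permAct (v : V) (σ : Equiv.Perm (Fin n))
    (y : ⨂[k] (_ : Fin n), Module.Dual k V) :
    tensorEval k V n v (permAct k n _ σ y) = tensorEval k V n v y := by
  induction y using PiTensorProduct.induction_on with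
  | smul_tprod r f =>
    rw [map_smul, map_smul, map_smul, permAct_tprod, tensorEval_tprod, tensorEval_tprod]
    exact congrArg _ (Equiv.prod_comp σ.symm fun a => f a v)
  | add x y hx hy => rw [map_add, map_add, map_add, hx, hy]

theorem tensorEval_eq_of_symQuot_eq (v : V) {y z : ⨂[k] (_ : Fin n), Module.Dual k V}
    (h : symQuot k n (Module.Dual k V) y = symQuot k n (Module.Dual k V) z) :
    tensorEval k V n v y = tensorEval k V n v z :=
  apply_eq_of_symQuot_eq k n _ _ (tensorEval_permAct k V n v) h

theorem tensorEval_tensorDualAct (ρ : Representation k G V) (g : G) (v : V)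
    (y : ⨂[k] (_ : Fin n), Module.Dual k V) :
    tensorEval k V n v (tensorDualAct k V n ρ g y) = tensorEval k V n (ρ g⁻¹ v) y := by
  induction y using PiTensorProduct.induction_on with
  | smul_tprod r f =>
    rw [map_smul, map_smul, map_smul, tensorDualAct, PiTensorProduct.map_tprod,
      tensorEval_tprod, tensorEval_tprod]
    rfl
  | add x y hx hy => rw [map_add, map_add, map_add, hx, hy]

theorem stmt4 (p : ℕ) (hp : 0 < p) [CharP k p] [FiniteDimensional k V]
    (ρ : Representation k G V)
    -- V has no G-stable codimension-1 subspace: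
    (hcodim : ∀ U : Submodule k V, (∀ g : G, ∀ v ∈ U, ρ g v ∈ U) →
      Module.finrank k (V ⧸ U) ≠ 1) :
    -- the multilinearization map φ : S^p(V^*) → ⊗^p V^* (characterized by
    -- φ ∘ ρ = s) is injective on G-invariants, i.e. its restriction to the
    -- invariants has trivial kernel:
    (∀ φ : SymPow k p (Module.Dual k V) →ₗ[k] ⨂[k] (_ : Fin p), Module.Dual k V,
      φ ∘ₗ symQuot k p (Module.Dual k V) = symmetrize k p (Module.Dual k V) →
      ∀ x : SymPow k p (Module.Dual k V), GInvariant k V p ρ x → φ x = 0 → x = 0) ∧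
    -- in particular, for p = 2: a G-invariant quadratic form on V with identically
    -- vanishing polar bilinear form is zero:
    (p = 2 → ∀ q : QuadraticForm k V, (∀ (g : G) (v : V), q (ρ g v) = q v) →
      (∀ v w : V, QuadraticMap.polar (⇑q) v w = 0) → q = 0) := by
  have : Fact p.Prime := ⟨(CharP.char_is_prime_or_zero k p).resolve_right hp.ne'⟩
  refine ⟨fun φ hφ x hx hx0 => ?_, ?_⟩
  · obtain ⟨y, rfl⟩ := Submodule.mkQ_surjective _ x
    change φ (symQuot k p (Module.Dual k V) y) = 0 at hx0
    change symQuot k p (Module.Dual k V) y = 0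
    let b := Module.finBasis k V
    obtain ⟨c, hc⟩ := exists_symQuot_eq_sum_pow k _ b.dualBasis p y
      (by rw [← hφ]; exact hx0)
    have hN (v : V) : tensorEval k V p v y = ∑ i, c i * b.repr v i ^ p := by
      rw [tensorEval_eq_of_symQuot_eq k V p v (z := ∑ i, c i • PiTensorProduct.tprod k
        fun _ => b.dualBasis i) (by rw [hc, map_sum]; simp only [map_smul])]
      simp [tensorEval_tprod]
    have hzero := eq_zero_of_invariant_frobenius_semilinear k V p ρ hcodim
      (fun v => tensorEval k V p v y)
      (fun v w => by simp [hN, add_pow_char, mul_add, Finset.sum_add_distrib])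
      (fun r v => by
        simp only [hN, Finset.mul_sum, map_smul, Finsupp.smul_apply, smul_eq_mul, mul_pow]
        exact Finset.sum_congr rfl fun i _ => by ring)
      (fun g v => by
        have h := tensorEval_tensorDualAct k V p ρ g⁻¹ v y
        rw [inv_inv] at h
        rw [← h]
        exact tensorEval_eq_of_symQuot_eq k V p v (hx g⁻¹ y rfl))
    rw [hc]
    refine Finset.sum_eq_zero fun j _ => ?_
    have hj := hzero (b j)
    simp only [hN, b.repr_self, Finsupp.single_apply, ite_pow, one_pow,
      zero_pow hp.ne', mul_ite, mul_one, mul_zero, Finset.sum_ite_eq, Finset.mem_univ,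
      if_true] at hj
    rw [hj, zero_smul]
  · rintro rfl q hq hpolar
    ext v
    refine eq_zero_of_invariant_frobenius_semilinear k V 2 ρ hcodim q (fun v w => ?_)
      (fun c v => by rw [QuadraticMap.map_smul, smul_eq_mul, sq]) hq v
    have h := hpolar v w
    rw [QuadraticMap.polar] at h
    linear_combination h
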